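/- (Separation of variables for the Meyers–Serrin operator) Fix an integer n ≥ 2, an integer ℓ ≥ 0 and a real b > 0. Let p : ℝⁿ → ℝ be a harmonic polynomial that is homogeneous of degree ℓ, and let φ : (0, ∞) → ℝ be twice continuously differentiable. Define u(x) = p(x) φ(|x|). Then for every x ∈ ℝⁿ with x ≠ 0, writing r = |x|: div(A_b(x) ∇u(x)) + (1/2) x · ∇u(x) + (n/2) u(x) = p(x) · [ φ''(r) + ((n−1+2ℓ)/r) φ'(r) + (1−b) (ℓ(n−2+ℓ)/r²) φ(r) + (r/2) φ'(r) + ((n+ℓ)/2) φ(r) ]. -/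

import Mathlib

open scoped RealInnerProductSpace

noncomputable section

/-- The divergence `div F(x) = ∑ᵢ ∂ᵢ Fᵢ(x)` of a vector field on `ℝⁿ`. -/
def diverg {n : ℕ} (F : EuclideanSpace ℝ (Fin n) → EuclideanSpace ℝ (Fin n))
    (x : EuclideanSpace ℝ (Fin n)) : ℝ :=
  ∑ i, fderiv ℝ F x (EuclideanSpace.single i 1) i

/-- The Meyers–Serrin matrix `A_b(x) = b·𝟙 + (1-b) (x⊗x)/|x|²`, acting on a vector `v`. -/
def meyersSerrin {n : ℕ} (b : ℝ) (x v : EuclideanSpace ℝ (Fin n)) :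
    EuclideanSpace ℝ (Fin n) :=
  b • v + (((1 - b) * ⟪x, v⟫) / ‖x‖ ^ 2) • x

theorem ms_sum_apply {n : ℕ} (f : EuclideanSpace ℝ (Fin n) →L[ℝ] ℝ)
    (v : EuclideanSpace ℝ (Fin n)) :
    ∑ i, f (EuclideanSpace.single i 1) * v i = f v := by
  have h := (EuclideanSpace.basisFun (Fin n) ℝ).sum_repr v
  conv_rhs => rw [← h]
  simp [map_sum, mul_comm]

theorem ms_diverg_smul {n : ℕ} {f : EuclideanSpace ℝ (Fin n) → ℝ}
    {V : EuclideanSpace ℝ (Fin n) → EuclideanSpace ℝ (Fin n)} {x : EuclideanSpace ℝ (Fin n)}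
    (hf : DifferentiableAt ℝ f x) (hV : DifferentiableAt ℝ V x) :
    diverg (fun z => f z • V z) x = f x * diverg V x + fderiv ℝ f x (V x) := by
  unfold diverg
  rw [← ms_sum_apply (fderiv ℝ f x), Finset.mul_sum, ← Finset.sum_add_distrib,
    (hf.hasFDerivAt.fun_smul hV.hasFDerivAt).fderiv]
  simp

theorem ms_diverg_add {n : ℕ}
    {V W : EuclideanSpace ℝ (Fin n) → EuclideanSpace ℝ (Fin n)} {x : EuclideanSpace ℝ (Fin n)}
    (hW : DifferentiableAt ℝ W x) (hV : DifferentiableAt ℝ V x) :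
    diverg (fun z => V z + W z) x = diverg V x + diverg W x := by
  unfold diverg
  rw [← Finset.sum_add_distrib, (hV.hasFDerivAt.fun_add hW.hasFDerivAt).fderiv]
  simp

theorem ms_diverg_id {n : ℕ} (x : EuclideanSpace ℝ (Fin n)) :
    diverg (fun z => z) x = n := by
  unfold diverg
  simp

theorem ms_contDiff {n : ℕ} (P : MvPolynomial (Fin n) ℝ) :
    ContDiff ℝ 2 (fun x : EuclideanSpace ℝ (Fin n) => MvPolynomial.eval (fun i => x i) P) := by
  induction P using MvPolynomial.induction_on with
  | C a => simpa using contDiff_const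
  | add p q hp hq => simpa using hp.add hq
  | mul_X p i hp =>
    simp only [map_mul, MvPolynomial.eval_X]
    exact hp.mul (by fun_prop)

theorem ms_norm {n : ℕ} {x : EuclideanSpace ℝ (Fin n)} (hx : x ≠ 0) :
    HasFDerivAt (fun z : EuclideanSpace ℝ (Fin n) => ‖z‖) (‖x‖⁻¹ • innerSL ℝ x) x := by
  have hr : ‖x‖ ≠ 0 := norm_ne_zero_iff.mpr hx
  have h := (hasStrictFDerivAt_norm_sq x).hasFDerivAt.sqrt (pow_ne_zero 2 hr)
  simp only [Real.sqrt_sq (norm_nonneg _)] at h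
  refine h.congr_fderiv ?_
  ext v
  simp
  field_simp

theorem ms_radial {n : ℕ} {x : EuclideanSpace ℝ (Fin n)} (hx : x ≠ 0) {k : ℝ → ℝ} {k' : ℝ}
    (hk : HasDerivAt k k' ‖x‖) :
    HasFDerivAt (fun z : EuclideanSpace ℝ (Fin n) => k ‖z‖) ((k' / ‖x‖) • innerSL ℝ x) x := by
  have h := hk.comp_hasFDerivAt x (ms_norm hx)
  rw [smul_smul] at h
  exact h

theorem ms_euler {n : ℕ} {p : EuclideanSpace ℝ (Fin n) → ℝ} {ℓ : ℕ}
    (hp_hom : ∀ t : ℝ, 0 < t → ∀ x, p (t • x) = t ^ ℓ * p x)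
    {x : EuclideanSpace ℝ (Fin n)} (hp : DifferentiableAt ℝ p x) :
    fderiv ℝ p x x = ℓ * p x := by
  have h0 : HasDerivAt (fun t : ℝ => t • x) x 1 := by
    simpa using (hasDerivAt_id (1 : ℝ)).smul_const x
  have h1 : HasDerivAt (fun t : ℝ => p (t • x)) (fderiv ℝ p x x) 1 := by
    have hp' : HasFDerivAt p (fderiv ℝ p x) ((1 : ℝ) • x) := by
      rw [one_smul]; exact hp.hasFDerivAt
    exact hp'.comp_hasDerivAt (1 : ℝ) h0
  have h2 : HasDerivAt (fun t : ℝ => t ^ ℓ * p x) (ℓ * p x) 1 := by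
    simpa using (hasDerivAt_pow ℓ (1 : ℝ)).mul_const (p x)
  refine h1.unique (h2.congr_of_eventuallyEq ?_)
  filter_upwards [lt_mem_nhds (zero_lt_one : (0 : ℝ) < 1)] with t ht
  exact hp_hom t ht x

/-- **Separation of variables for the Meyers–Serrin operator** (formula `(Lbldef)` of the
paper). If `p` is a harmonic polynomial homogeneous of degree `ℓ`, `φ` is `C²` on `(0,∞)`
and `u(x) = p(x) φ(|x|)`, then for `x ≠ 0`, `r = |x|`:
`div(A_b ∇u) + ½ x·∇u + (n/2) u
  = p(x) (φ'' + ((n-1+2ℓ)/r) φ' + (1-b)(ℓ(n-2+ℓ)/r²) φ + (r/2) φ' + ((n+ℓ)/2) φ)`. -/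
theorem meyersSerrin_separation_of_variables
    {n : ℕ} (hn : 2 ≤ n) (ℓ : ℕ) (b : ℝ) (hb : 0 < b)
    (p : EuclideanSpace ℝ (Fin n) → ℝ)
    (hp_poly : ∃ P : MvPolynomial (Fin n) ℝ,
      ∀ x : EuclideanSpace ℝ (Fin n), p x = MvPolynomial.eval (fun i => x i) P)
    (hp_harm : ∀ x, diverg (gradient p) x = 0)
    (hp_hom : ∀ t : ℝ, 0 < t → ∀ x, p (t • x) = t ^ ℓ * p x)
    (φ : ℝ → ℝ) (hφ : ContDiffOn ℝ 2 φ (Set.Ioi 0))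
    (u : EuclideanSpace ℝ (Fin n) → ℝ)
    (hu : ∀ x, u x = p x * φ ‖x‖) :
    ∀ x : EuclideanSpace ℝ (Fin n), x ≠ 0 →
      diverg (fun z => meyersSerrin b z (gradient u z)) x
          + (1 / 2) * ⟪x, gradient u x⟫ + ((n : ℝ) / 2) * u x
        = p x * (deriv (deriv φ) ‖x‖
            + (((n : ℝ) - 1 + 2 * ℓ) / ‖x‖) * deriv φ ‖x‖
            + (1 - b) * ((ℓ : ℝ) * ((n : ℝ) - 2 + ℓ) / ‖x‖ ^ 2) * φ ‖x‖
            + (‖x‖ / 2) * deriv φ ‖x‖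
            + (((n : ℝ) + ℓ) / 2) * φ ‖x‖) := by
  intro x hx
  obtain ⟨P, hP⟩ := hp_poly
  have hpC : ContDiff ℝ 2 p := by
    rw [show p = _ from funext hP]; exact ms_contDiff P
  have hpd : Differentiable ℝ p := hpC.differentiable (by norm_num)
  have hgd : Differentiable ℝ (gradient p) := by
    have h1 : Differentiable ℝ (fderiv ℝ p) :=
      (hpC.fderiv_right (m := 1) (by norm_num)).differentiable (by norm_num)
    exact (InnerProductSpace.toDual ℝ
      (EuclideanSpace ℝ (Fin n))).symm.toContinuousLinearEquiv.differentiable.comp h1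
  have hφ1 : ∀ r : ℝ, 0 < r → HasDerivAt φ (deriv φ r) r := fun r hr =>
    ((hφ.contDiffAt (Ioi_mem_nhds hr)).differentiableAt (by norm_num)).hasDerivAt
  have hφ2 : ∀ r : ℝ, 0 < r → HasDerivAt (deriv φ) (deriv (deriv φ) r) r := by
    intro r hr
    have h1 : ContDiffOn ℝ 1 (deriv φ) (Set.Ioi 0) :=
      hφ.deriv_of_isOpen isOpen_Ioi (by norm_num)
    exact ((h1.contDiffAt (Ioi_mem_nhds hr)).differentiableAt (by norm_num)).hasDerivAt
  have hgu : ∀ z : EuclideanSpace ℝ (Fin n), z ≠ 0 →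
      gradient u z = φ ‖z‖ • gradient p z + (p z * (deriv φ ‖z‖ / ‖z‖)) • z := by
    intro z hz
    apply HasGradientAt.gradient
    rw [hasGradientAt_iff_hasFDerivAt, show u = _ from funext hu]
    have h := (hpd z).hasFDerivAt.mul (ms_radial hz (hφ1 ‖z‖ (norm_pos_iff.mpr hz)))
    refine HasFDerivAt.congr_fderiv h ?_
    ext v
    simp [inner_add_left, inner_smul_left, inner_gradient_left]
    ring
  have hin : ∀ z : EuclideanSpace ℝ (Fin n), z ≠ 0 →
      ⟪z, gradient u z⟫ = p z * (ℓ * φ ‖z‖ + ‖z‖ * deriv φ ‖z‖) := by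
    intro z hz
    have hr : ‖z‖ ≠ 0 := norm_ne_zero_iff.mpr hz
    rw [hgu z hz, inner_add_right, inner_smul_right, inner_smul_right, inner_gradient_right,
      real_inner_self_eq_norm_sq, ms_euler hp_hom (hpd z)]
    simp
    field_simp
  set k : ℝ → ℝ := fun r => deriv φ r / r + (1 - b) * ℓ * (φ r / r ^ 2) with hk
  have hr : 0 < ‖x‖ := norm_pos_iff.mpr hx
  have hr' := hr.ne'
  have hF : (fun z => meyersSerrin b z (gradient u z)) =ᶠ[nhds x]
      fun z => (b * φ ‖z‖) • gradient p z + (p z * k ‖z‖) • z := by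
    filter_upwards [isOpen_ne.mem_nhds hx] with z hz
    have hzr : ‖z‖ ≠ 0 := norm_ne_zero_iff.mpr hz
    unfold meyersSerrin
    rw [hin z hz, hgu z hz, smul_add, smul_smul, smul_smul, add_assoc, ← add_smul]
    congr 2
    simp only [hk]
    field_simp
    ring
  have hdk := ((hφ2 _ hr).div (hasDerivAt_id ‖x‖) hr').add
    (((hφ1 _ hr).div (hasDerivAt_pow 2 ‖x‖) (pow_ne_zero 2 hr')).const_mul ((1 - b) * ℓ))
  have hK := ms_radial (k := k) hx hdk
  have hH := (hpd x).hasFDerivAt.mul hK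
  have hΦ := (ms_radial hx (hφ1 _ hr)).const_mul b
  have hdiv : diverg (fun z => meyersSerrin b z (gradient u z)) x =
      diverg (fun z => (b * φ ‖z‖) • gradient p z + (p z * k ‖z‖) • z) x := by
    unfold diverg
    rw [hF.fderiv_eq]
  have hHd : DifferentiableAt ℝ (fun z => p z * k ‖z‖) x := hH.differentiableAt
  have hH' : fderiv ℝ (fun z => p z * k ‖z‖) x = _ := hH.fderiv
  rw [hdiv, ms_diverg_add (hHd.fun_smul differentiableAt_fun_id)
    (hΦ.differentiableAt.fun_smul (hgd x)), ms_diverg_smul hΦ.differentiableAt (hgd x),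
    ms_diverg_smul hHd differentiableAt_fun_id, ms_diverg_id, hp_harm, hin x hx, hu x,
    hΦ.fderiv, hH']
  simp [ms_euler hp_hom (hpd x), inner_gradient_right, real_inner_self_eq_norm_sq, hk]
  field_simp
  ring

end
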